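/- arXiv:1308.6366 — 2 statements merged into one kernel-verified Lean document; each statement's English description precedes it below -/
import Mathlib

section
/- (Conley) Let M be a locally compact metric space and let φ be a flow on M. Then every isolated invariant set S ⊆ M admits an index pair (N, L). -/
open Set

/-- The maximal invariant subset `Inv(N, φ)` of a set `N` under a flow `φ`. -/
def maxInvariantSet {M : Type*} [TopologicalSpace M] (φ : Flow ℝ M) (N : Set M) : Set M :=
  {x ∈ N | ∀ t : ℝ, φ t x ∈ N}

/-- A compact set `N` is an isolating neighborhood for the flow `φ` if `Inv(N, φ) ⊆ int N`. -/
def IsIsolatingNbhd {M : Type*} [TopologicalSpace M] (φ : Flow ℝ M) (N : Set M) : Prop :=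
  IsCompact N ∧ maxInvariantSet φ N ⊆ interior N

/-- `S` is an isolated invariant set for `φ` if `S = Inv(N, φ)` for some isolating
neighborhood `N`. -/
def IsIsolatedInvariantSet {M : Type*} [TopologicalSpace M] (φ : Flow ℝ M) (S : Set M) : Prop :=
  ∃ N : Set M, IsIsolatingNbhd φ N ∧ S = maxInvariantSet φ N

/-- `(N, L)` is an index pair for the isolated invariant set `S` in the flow `φ`:
`L ⊆ N` are compact, `Inv(N \ L, φ) = S ⊆ int (N \ L)`, `L` is an exit set for `N`,
and `L` is positively invariant in `N`. -/
def IsIndexPair {M : Type*} [TopologicalSpace M] (φ : Flow ℝ M) (S N L : Set M) : Prop :=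
  IsCompact N ∧ IsCompact L ∧ L ⊆ N ∧
  maxInvariantSet φ (N \ L) = S ∧ S ⊆ interior (N \ L) ∧
  (∀ x ∈ N, ∀ t : ℝ, 0 < t → φ t x ∉ N → ∃ τ : ℝ, 0 ≤ τ ∧ τ < t ∧ φ τ x ∈ L) ∧
  (∀ x ∈ L, ∀ t : ℝ, 0 < t → (∀ s : ℝ, 0 ≤ s → s ≤ t → φ s x ∈ N) →
    ∀ s : ℝ, 0 ≤ s → s ≤ t → φ s x ∈ L)

section IndexPair

variable {M : Type*} [TopologicalSpace M]

/-- The points whose forward orbit under `φ` stays in `K`. -/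
def forwardInvariantPart (φ : Flow ℝ M) (K : Set M) : Set M :=
  {x | ∀ t : ℝ, 0 ≤ t → φ t x ∈ K}

/-- The points reached from `Y` by following `φ` forward in time without leaving `K`. -/
def forwardHull (φ : Flow ℝ M) (K Y : Set M) : Set M :=
  {z | ∃ t : ℝ, 0 ≤ t ∧ φ (-t) z ∈ Y ∧ ∀ s : ℝ, 0 ≤ s → s ≤ t → φ (-s) z ∈ K}

variable {φ : Flow ℝ M} {K Y : Set M}

theorem forwardInvariantPart_subset : forwardInvariantPart φ K ⊆ K := fun x hx => by
  simpa using hx 0 le_rfl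

theorem isClosed_forwardInvariantPart (hK : IsClosed K) :
    IsClosed (forwardInvariantPart φ K) := by
  simp only [forwardInvariantPart, ofPred_forall]
  exact isClosed_iInter fun t => isClosed_iInter fun _ => hK.preimage (φ.continuous_toFun t)

theorem maxInvariantSet_eq_inter :
    maxInvariantSet φ K = forwardInvariantPart φ K ∩ forwardInvariantPart φ.reverse K := by
  ext x
  constructor
  · rintro ⟨_, hx⟩
    exact ⟨fun t _ => hx t, fun t _ => hx (-t)⟩
  · rintro ⟨hp, hm⟩
    refine ⟨forwardInvariantPart_subset hp, fun t => ?_⟩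
    rcases le_total 0 t with ht | ht
    · exact hp t ht
    · have h : φ (- -t) x ∈ K := hm (-t) (by linarith)
      rwa [neg_neg] at h

theorem forwardHull_subset : forwardHull φ K Y ⊆ K := by
  rintro z ⟨t, ht, -, hz⟩
  simpa using hz 0 le_rfl ht

theorem subset_forwardHull (hY : Y ⊆ K) : Y ⊆ forwardHull φ K Y := by
  intro y hy
  refine ⟨0, le_rfl, by simpa using hy, fun s h0 h1 => ?_⟩
  obtain rfl : s = 0 := le_antisymm h1 h0
  simpa using hY hy

theorem map_mem_forwardHull {z : M} (hz : z ∈ forwardHull φ K Y) {t : ℝ} (ht : 0 ≤ t)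
    (h : ∀ s : ℝ, 0 ≤ s → s ≤ t → φ s z ∈ K) : φ t z ∈ forwardHull φ K Y := by
  obtain ⟨r, hr, hY, hK⟩ := hz
  refine ⟨r + t, by linarith, ?_, fun s h0 h1 => ?_⟩
  · rwa [← φ.map_add, show -(r + t) + t = -r by ring]
  · rw [← φ.map_add]
    rcases le_total s t with hst | hst
    · exact h _ (by linarith) (by linarith)
    · have := hK (s - t) (by linarith) (by linarith)
      rwa [show -s + t = -(s - t) by ring]

theorem disjoint_forwardHull_forwardInvariantPart
    (h : Disjoint Y (forwardInvariantPart φ K)) :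
    Disjoint (forwardHull φ K Y) (forwardInvariantPart φ K) := by
  rw [Set.disjoint_left] at h ⊢
  rintro z ⟨t, ht, hY, hK⟩ hz
  refine h hY fun s hs => ?_
  rw [← φ.map_add]
  rcases le_total t s with hts | hts
  · exact hz _ (by linarith)
  · have := hK (t - s) (by linarith) (by linarith)
    rwa [show s + -t = -(t - s) by ring]

theorem isClosed_forwardHull_bounded (hK : IsClosed K) (hY : IsClosed Y) (T : ℝ) :
    IsClosed {z | ∃ t : ℝ, (0 ≤ t ∧ t ≤ T) ∧ φ (-t) z ∈ Y ∧
      ∀ s : ℝ, 0 ≤ s → s ≤ t → φ (-s) z ∈ K} := by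
  have hcl : IsClosed {p : Icc (0 : ℝ) T × M | φ (-p.1.1) p.2 ∈ Y ∧
      ∀ r : Icc (0 : ℝ) 1, φ (-(r.1 * p.1.1)) p.2 ∈ K} := by
    simp only [ofPred_and, ofPred_forall]
    refine (hY.preimage ?_).inter (isClosed_iInter fun r => hK.preimage ?_)
    · exact φ.continuous (by fun_prop) (by fun_prop)
    · exact φ.continuous (by fun_prop) (by fun_prop)
  convert isClosedMap_snd_of_compactSpace _ hcl using 1
  ext z
  constructor
  · rintro ⟨t, ht, hz, h⟩
    exact ⟨(⟨t, ht⟩, z), ⟨hz, fun r => h _ (mul_nonneg r.2.1 ht.1)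
      (mul_le_of_le_one_left ht.1 r.2.2)⟩, rfl⟩
  · rintro ⟨⟨⟨t, ht⟩, z'⟩, ⟨hz, h⟩, rfl⟩
    refine ⟨t, ht, hz, fun s h0 h1 => ?_⟩
    rcases ht.1.eq_or_lt with rfl | hpos
    · obtain rfl : s = 0 := le_antisymm h1 h0
      simpa using h ⟨0, by simp⟩
    · simpa [div_mul_cancel₀ s hpos.ne'] using
        h ⟨s / t, div_nonneg h0 hpos.le, (div_le_one hpos).2 h1⟩

/-- A limit of points of `forwardHull φ K Y` with unbounded travel times lies in the set of points
whose backward orbit stays in `K`; if `Y` contains that set, the hull is closed. -/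
theorem isClosed_forwardHull_of_subset (hK : IsClosed K) (hY : IsClosed Y) (hYK : Y ⊆ K)
    (h : forwardInvariantPart φ.reverse K ⊆ Y) : IsClosed (forwardHull φ K Y) := by
  refine isClosed_of_closure_subset fun z hz => ?_
  by_cases hzA : z ∈ forwardInvariantPart φ.reverse K
  · exact subset_forwardHull hYK (h hzA)
  obtain ⟨T, hT, hzT⟩ : ∃ T : ℝ, 0 ≤ T ∧ φ (-T) z ∉ K := by
    simpa [forwardInvariantPart, Flow.reverse] using hzA
  have hO : IsOpen {x | φ (-T) x ∈ Kᶜ} := hK.isOpen_compl.preimage (φ.continuous_toFun (-T))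
  have hsub : {x | φ (-T) x ∈ Kᶜ} ∩ forwardHull φ K Y ⊆ {z | ∃ t : ℝ, (0 ≤ t ∧ t ≤ T) ∧
      φ (-t) z ∈ Y ∧ ∀ s : ℝ, 0 ≤ s → s ≤ t → φ (-s) z ∈ K} := by
    rintro x ⟨hxT, t, ht, hxY, hx⟩
    exact ⟨t, ⟨ht, le_of_not_gt fun hlt => hxT (hx T hT hlt.le)⟩, hxY, hx⟩
  have hz' := closure_minimal hsub (isClosed_forwardHull_bounded hK hY T)
    (hO.inter_closure ⟨hzT, hz⟩)
  obtain ⟨t, ht, hz'⟩ := hz'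
  exact ⟨t, ht.1, hz'⟩

theorem exists_uniform_exit_time (hK : IsClosed K) (hY : IsCompact Y)
    (h : Disjoint Y (forwardInvariantPart φ K)) :
    ∃ T : ℝ, ∀ y ∈ Y, ∃ s : ℝ, 0 ≤ s ∧ s ≤ T ∧ φ s y ∉ K := by
  obtain ⟨T, hT⟩ := hY.elim_directed_cover
    (fun T : ℝ => {y | ∃ s : ℝ, 0 ≤ s ∧ s ≤ T ∧ φ s y ∉ K}) (fun T => by
      have : {y | ∃ s : ℝ, 0 ≤ s ∧ s ≤ T ∧ φ s y ∉ K} =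
          ⋃ s : Icc (0 : ℝ) T, φ s.1 ⁻¹' Kᶜ := by
        ext y
        simp [and_assoc]
      rw [this]
      exact isOpen_iUnion fun s => hK.isOpen_compl.preimage (φ.continuous_toFun s.1))
    (fun y hy => by
      obtain ⟨s, hs, hys⟩ : ∃ s : ℝ, 0 ≤ s ∧ φ s y ∉ K := by
        simpa [forwardInvariantPart] using Set.disjoint_left.1 h hy
      exact mem_iUnion.2 ⟨s, s, hs, le_rfl, hys⟩)
    (Monotone.directed_le fun a b hab y hy => by
      obtain ⟨s, h0, h1, h2⟩ := hy
      exact ⟨s, h0, h1.trans hab, h2⟩)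
  exact ⟨T, fun y hy => hT hy⟩

theorem isClosed_forwardHull_of_disjoint (hK : IsClosed K) (hYc : IsClosed Y) (hY : IsCompact Y)
    (h : Disjoint Y (forwardInvariantPart φ K)) : IsClosed (forwardHull φ K Y) := by
  obtain ⟨T, hT⟩ := exists_uniform_exit_time hK hY h
  convert isClosed_forwardHull_bounded hK hYc T using 1
  ext z
  constructor
  · rintro ⟨t, ht, hzY, hz⟩
    refine ⟨t, ⟨ht, ?_⟩, hzY, hz⟩
    obtain ⟨s, hs, hsT, hsK⟩ := hT _ hzY
    by_contra! hlt
    have := hz (t - s) (by linarith) (by linarith)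
    rw [← φ.map_add, show s + -t = -(t - s) by ring] at hsK
    exact hsK this
  · rintro ⟨t, ht, hz⟩
    exact ⟨t, ht.1, hz⟩

/-- Two closed sets whose intersection lies in an open set `U` have open neighborhoods whose
intersection lies in `U`. -/
theorem exists_open_nhds_inter_subset [NormalSpace M] {A B U : Set M} (hA : IsClosed A)
    (hB : IsClosed B) (hU : IsOpen U) (h : A ∩ B ⊆ U) :
    ∃ V W : Set M, IsOpen V ∧ IsOpen W ∧ A ⊆ V ∧ B ⊆ W ∧ V ∩ W ⊆ U := by
  obtain ⟨V, W, hV, hW, hAV, hBW, hVW⟩ := normal_separation (hA.sdiff hU) (hB.sdiff hU)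
    (Set.disjoint_left.2 fun x hx hx' => hx.2 (h ⟨hx.1, hx'.1⟩))
  refine ⟨V ∪ U, W ∪ U, hV.union hU, hW.union hU, ?_, ?_, ?_⟩
  · exact fun x hx => or_iff_not_imp_right.2 fun hxU => hAV ⟨hx, hxU⟩
  · exact fun x hx => or_iff_not_imp_right.2 fun hxU => hBW ⟨hx, hxU⟩
  · rw [← inter_union_distrib_right, hVW.inter_eq, empty_union]

/-- The forward hull of a neighborhood `Y` of the points with backward orbit in `K` can only be
left through a set `L` such that the hull minus `L` is interior to `K`. -/
theorem exists_mem_of_leaves_forwardHull {L : Set M} (hcl : IsClosed (forwardHull φ K Y))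
    (hL : forwardHull φ K Y \ L ⊆ interior K) {x : M} (hx : x ∈ forwardHull φ K Y) {t : ℝ}
    (ht : 0 < t) (hxt : φ t x ∉ forwardHull φ K Y) : ∃ τ : ℝ, 0 ≤ τ ∧ τ < t ∧ φ τ x ∈ L := by
  by_contra! hno
  have hcont : Continuous fun s : ℝ => φ s x := φ.continuous continuous_id continuous_const
  refine hxt (IsClosed.Icc_subset_of_forall_exists_gt (s := {s | φ s x ∈ forwardHull φ K Y})
    ((hcl.preimage hcont).inter isClosed_Icc) (by simpa using hx) ?_ ⟨ht.le, le_rfl⟩)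
  rintro s ⟨hs, hs0, hst⟩ y hy
  have hint : φ s x ∈ interior K := hL ⟨hs, hno s hs0 hst⟩
  obtain ⟨ε, hε, hball⟩ := Metric.isOpen_iff.1 (isOpen_interior.preimage hcont) s hint
  obtain ⟨r, hr0, hr⟩ := exists_between (lt_min hε (sub_pos.2 (mem_Ioi.1 hy)))
  refine ⟨s + r, ?_, by linarith, by linarith [min_le_right ε (y - s)]⟩
  have key := map_mem_forwardHull hs hr0.le fun q hq0 hq1 => by
    rw [← φ.map_add]
    refine interior_subset (hball (a := q + s) ?_)
    rw [Metric.mem_ball, Real.dist_eq, add_sub_cancel_right, abs_of_nonneg hq0]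
    linarith [min_le_left ε (y - s)]
  rwa [← φ.map_add, add_comm] at key

end IndexPair

/-- (Conley) In a locally compact metric space, every isolated invariant set of a flow
admits an index pair. -/
theorem exists_index_pair
    {M : Type*} [MetricSpace M] [LocallyCompactSpace M]
    (φ : Flow ℝ M) (S : Set M) (hS : IsIsolatedInvariantSet φ S) :
    ∃ N L : Set M, IsIndexPair φ S N L := by
  obtain ⟨K, ⟨hKc, hKint⟩, rfl⟩ := hS
  have hK := hKc.isClosed
  have hSeq := maxInvariantSet_eq_inter (φ := φ) (K := K)
  have hAm := isClosed_forwardInvariantPart (φ := φ.reverse) hK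
  obtain ⟨V, V', hV, hV', hAV, hAV', hVV'⟩ := exists_open_nhds_inter_subset
    (isClosed_forwardInvariantPart (φ := φ) hK) hAm isOpen_interior (hSeq ▸ hKint)
  have hdisj : Disjoint (K \ V) (forwardInvariantPart φ K) :=
    disjoint_sdiff_left.mono_right hAV
  have hdisj' : Disjoint (K \ V') (forwardInvariantPart φ.reverse K) :=
    disjoint_sdiff_left.mono_right hAV'
  have hLcl : IsClosed (forwardHull φ K (K \ V)) :=
    isClosed_forwardHull_of_disjoint hK (hK.sdiff hV) (hKc.diff hV) hdisj
  have hLdisj := disjoint_forwardHull_forwardInvariantPart hdisj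
  have hQcl : IsClosed (forwardHull φ.reverse K (K \ V')) :=
    isClosed_forwardHull_of_disjoint hK (hK.sdiff hV') (hKc.diff hV') hdisj'
  have hQdisj := disjoint_forwardHull_forwardInvariantPart hdisj'
  obtain ⟨G, hG, hAG, hGQ⟩ := normal_exists_closure_subset hAm hQcl.isOpen_compl
    (subset_compl_iff_disjoint_left.2 hQdisj)
  set L := forwardHull φ K (K \ V) with hLdef
  set P := forwardHull φ K (K ∩ closure G) with hPdef
  have hPcl : IsClosed P := isClosed_forwardHull_of_subset hK (hK.inter isClosed_closure)
    inter_subset_left (subset_inter forwardInvariantPart_subset (hAG.trans subset_closure))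
  have hLK : L ⊆ K := forwardHull_subset
  have hPK : P ⊆ K := forwardHull_subset
  have hNK : P ∪ L ⊆ K := union_subset hPK hLK
  have hPV' : P ⊆ V' := by
    rintro z ⟨t, ht, hzG, hz⟩
    by_contra hzV
    refine hGQ hzG.2 ⟨t, ht, ?_, fun s h0 h1 => ?_⟩
    · change φ (- -t) (φ (-t) z) ∈ K \ V'
      rw [← φ.map_add, neg_neg, add_neg_cancel, φ.map_zero_apply]
      exact ⟨by simpa using hz 0 le_rfl ht, hzV⟩
    · change φ (- -s) (φ (-t) z) ∈ K
      rw [← φ.map_add, show - -s + -t = -(t - s) by ring]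
      exact hz _ (by linarith) (by linarith)
  have hPL : P \ L ⊆ interior K := fun z hz => hVV' ⟨by
    by_contra hzV
    exact hz.2 (subset_forwardHull sdiff_subset ⟨hPK hz.1, hzV⟩), hPV' hz.1⟩
  have hSint : maxInvariantSet φ K ⊆ interior ((P ∪ L) \ L) := by
    refine fun x hx => mem_interior.2 ⟨(interior K ∩ G) \ L, ?_,
      (isOpen_interior.inter hG).sdiff hLcl, ?_⟩
    · exact fun y hy => ⟨Or.inl (subset_forwardHull inter_subset_left
        ⟨interior_subset hy.1.1, subset_closure hy.1.2⟩), hy.2⟩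
    · have hx' := hSeq ▸ hx
      exact ⟨⟨hKint hx, hAG hx'.2⟩, Set.disjoint_right.1 hLdisj hx'.1⟩
  refine ⟨P ∪ L, L, hKc.of_isClosed_subset (hPcl.union hLcl) hNK,
    hKc.of_isClosed_subset hLcl hLK, subset_union_right, ?_, hSint, ?_, ?_⟩
  · refine Subset.antisymm (fun x hx => ⟨hNK hx.1.1, fun t => hNK (hx.2 t).1⟩) fun x hx => ?_
    refine ⟨interior_subset (hSint hx), fun t => interior_subset (hSint ⟨hx.2 t, fun s => ?_⟩)⟩
    rw [← φ.map_add]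
    exact hx.2 _
  · rintro x (hx | hx) t ht hxt
    · exact exists_mem_of_leaves_forwardHull hPcl hPL hx ht fun h => hxt (Or.inl h)
    · exact ⟨0, le_rfl, ht, by simpa using hx⟩
  · intro x hx t _ h s hs0 hst
    exact map_mem_forwardHull hx hs0 fun r hr0 hr => hNK (h r hr0 (hr.trans hst))
end

section
/- (Floer; Pruszko: equivariant index pairs) Let M be a locally compact metric space, let φ be a flow on M, and let G be a compact topological group acting continuously on M so that the action commutes with the flow: φ_t(g·x) = g·φ_t(x) for all g ∈ G, t ∈ ℝ, x ∈ M. Let S ⊆ M be an isolated invariant set which is G-invariant (g·S = S for all g ∈ G) and which admits a G-invariant isolating neighborhood. Then there exists an index pair (N, L) for S with both N and L G-invariant, i.e. g·N = N and g·L = L for all g ∈ G. -/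
open Set

open Pointwise

section OrbitSegments

variable {M : Type*} [TopologicalSpace M] (φ : Flow ℝ M)

/-- The points whose orbit stays in `A` during the whole time interval `[a, b]`. -/
def orbitSegmentSet (a b : ℝ) (A : Set M) : Set M :=
  {x | ∀ s ∈ Icc a b, φ s x ∈ A}

variable {φ}

lemma isClosed_orbitSegmentSet {a b : ℝ} {A : Set M} (hA : IsClosed A) :
    IsClosed (orbitSegmentSet φ a b A) := by
  simp only [orbitSegmentSet, ofPred_forall]
  exact isClosed_iInter fun s => isClosed_iInter fun _ =>
    hA.preimage (φ.continuous continuous_const continuous_id)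

lemma isOpen_orbitSegmentSet {a b : ℝ} {A : Set M} (hA : IsOpen A) :
    IsOpen (orbitSegmentSet φ a b A) := by
  refine isOpen_iff_mem_nhds.2 fun x hx => ?_
  have hφ : Continuous fun p : M × ℝ => φ p.2 p.1 := φ.continuous continuous_snd continuous_fst
  exact isCompact_Icc.eventually_forall_of_forall_eventually fun s hs =>
    hφ.continuousAt.eventually (hA.mem_nhds (hx s hs))

lemma orbitSegmentSet_mono {a b a' b' : ℝ} {A B : Set M} (ha : a ≤ a') (hb : b' ≤ b)
    (hAB : A ⊆ B) : orbitSegmentSet φ a b A ⊆ orbitSegmentSet φ a' b' B :=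
  fun _ hx s hs => hAB (hx s ⟨ha.trans hs.1, hs.2.trans hb⟩)

lemma map_mem_maxInvariantSet {A : Set M} {x : M} (hx : x ∈ maxInvariantSet φ A) (t : ℝ) :
    φ t x ∈ maxInvariantSet φ A :=
  ⟨hx.2 t, fun s => by rw [← φ.map_add]; exact hx.2 _⟩

lemma maxInvariantSet_subset_orbitSegmentSet {A : Set M}
    (hA : maxInvariantSet φ A ⊆ interior A) (a b : ℝ) :
    maxInvariantSet φ A ⊆ orbitSegmentSet φ a b (interior A) :=
  fun _ hx s _ => hA (map_mem_maxInvariantSet hx s)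

/-- Points near the boundary of an isolating neighborhood leave it within a uniformly
bounded time, forwards or backwards. -/
lemma IsIsolatingNbhd.exists_orbitSegmentSet_subset [T2Space M] {K : Set M}
    (hK : IsIsolatingNbhd φ K) :
    ∃ T : ℝ, 0 ≤ T ∧ orbitSegmentSet φ (-T) T K ⊆ interior K := by
  have hsub (n : ℕ) : orbitSegmentSet φ (-(n : ℝ)) n K ⊆ K := fun x hx => by
    simpa using hx 0 ⟨by simp, by simp⟩
  have hcl (n : ℕ) : IsClosed (orbitSegmentSet φ (-(n : ℝ)) n K) :=
    isClosed_orbitSegmentSet hK.1.isClosed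
  have hanti : Antitone fun n : ℕ => orbitSegmentSet φ (-(n : ℝ)) n K := fun m n hmn =>
    orbitSegmentSet_mono (neg_le_neg (by exact_mod_cast hmn)) (by exact_mod_cast hmn) subset_rfl
  obtain ⟨n, hn⟩ := exists_subset_nhds_of_isCompact' hanti.directed_ge
    (fun n => hK.1.of_isClosed_subset (hcl n) (hsub n)) hcl (U := interior K) fun x hx => by
      rw [mem_iInter] at hx
      refine isOpen_interior.mem_nhds (hK.2 ⟨hsub 0 (hx 0), fun t => ?_⟩)
      obtain ⟨n, hn⟩ := exists_nat_ge |t|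
      exact hx n t (abs_le.1 hn)
  exact ⟨n, n.cast_nonneg, hn⟩

/-- If orbit segments in `K` over `[-T, T]` are centred in the interior of `K`, then the points
which have been in `K` for time `T`, together with those among them which leave the interior of `K`
within time `T`, form an index pair. -/
lemma isIndexPair_orbitSegmentSet [T2Space M] {K : Set M} (hK : IsIsolatingNbhd φ K) {T : ℝ}
    (hT : 0 ≤ T) (hTK : orbitSegmentSet φ (-T) T K ⊆ interior K) :
    IsIndexPair φ (maxInvariantSet φ K) (orbitSegmentSet φ (-T) 0 K)
      (orbitSegmentSet φ (-T) 0 K \ orbitSegmentSet φ 0 T (interior K)) := by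
  set N := orbitSegmentSet φ (-T) 0 K with hN
  set U := orbitSegmentSet φ 0 T (interior K) with hU
  have hNK : N ⊆ K := fun x hx => by simpa using hx 0 ⟨by simpa using hT, le_rfl⟩
  have hNc : IsCompact N :=
    hK.1.of_isClosed_subset (isClosed_orbitSegmentSet hK.1.isClosed) hNK
  have hSNU : maxInvariantSet φ K ⊆ interior (N \ (N \ U)) := by
    refine (maxInvariantSet_subset_orbitSegmentSet hK.2 (-T) T).trans
      (interior_maximal ?_ (isOpen_orbitSegmentSet isOpen_interior))
    rw [sdiff_sdiff_right_self]
    exact subset_inter (orbitSegmentSet_mono le_rfl hT interior_subset)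
      (orbitSegmentSet_mono (by simpa using hT) le_rfl subset_rfl)
  refine ⟨hNc, hNc.diff (isOpen_orbitSegmentSet isOpen_interior), sdiff_subset, ?_, hSNU, ?_, ?_⟩
  · refine Subset.antisymm (fun x hx => ⟨hNK hx.1.1, fun t => hNK (hx.2 t).1⟩) fun x hx =>
      ⟨interior_subset (hSNU hx), fun t => interior_subset (hSNU (map_mem_maxInvariantSet hx t))⟩
  · intro x hx t ht hxt
    obtain ⟨s, hs, hsK⟩ : ∃ s ∈ Icc (-T) 0, φ (s + t) x ∉ K := by
      simpa [hN, orbitSegmentSet, φ.map_add, and_assoc] using hxt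
    have hst : 0 < s + t := by
      by_contra! h
      exact hsK (hx _ ⟨by linarith [hs.1], h⟩)
    have hφ : Continuous fun r => φ r x := φ.continuous continuous_id continuous_const
    obtain ⟨τ, ⟨⟨hτ0, hτt⟩, hτK⟩, hτmin⟩ :
        ∃ τ, IsLeast (Icc 0 (s + t) ∩ (fun r => φ r x) ⁻¹' (interior K)ᶜ) τ :=
      (isCompact_Icc.inter_right
        (isOpen_interior.isClosed_compl.preimage hφ)).exists_isLeast
        ⟨s + t, ⟨hst.le, le_rfl⟩, fun h => hsK (interior_subset h)⟩
    have hbefore : ∀ r, 0 ≤ r → r < τ → φ r x ∈ K := fun r hr hrτ => by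
      by_contra h
      exact (hτmin ⟨⟨hr, by linarith⟩, fun h' => h (interior_subset h')⟩).not_gt hrτ
    have hτmem : φ τ x ∈ K := by
      rcases hτ0.eq_or_lt with rfl | hpos
      · simpa using hNK hx
      · have hcl : IsClosed ((fun r => φ r x) ⁻¹' K) := hK.1.isClosed.preimage hφ
        have hsub : closure (Ico 0 τ) ⊆ (fun r => φ r x) ⁻¹' K :=
          closure_minimal (fun r hr => hbefore r hr.1 hr.2) hcl
        rw [closure_Ico hpos.ne] at hsub
        exact hsub ⟨hτ0, le_rfl⟩
    have hτlt : τ < s + t := hτt.lt_of_ne fun h => hsK (h ▸ hτmem)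
    refine ⟨τ, hτ0, by linarith [hs.2], fun r hr => ?_, fun h => hτK ?_⟩
    · rw [← φ.map_add]
      rcases lt_or_ge (r + τ) 0 with h | h
      · exact hx _ ⟨by linarith [hr.1], h.le⟩
      · rcases hr.2.eq_or_lt with rfl | hr0
        · simpa using hτmem
        · exact hbefore _ h (by linarith)
    · simpa using h 0 ⟨le_rfl, hT⟩
  · intro x hx t _ hstay s hs0 hst
    refine ⟨hstay s hs0 hst, fun hsU => ?_⟩
    obtain ⟨r, hr, hrK⟩ : ∃ r ∈ Icc 0 T, φ r x ∉ interior K := by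
      simpa [hU, orbitSegmentSet, and_assoc] using hx.2
    rcases le_or_gt s r with hsr | hrs
    · refine hrK ?_
      have := hsU (r - s) ⟨by linarith, by linarith [hr.2]⟩
      rwa [← φ.map_add, sub_add_cancel] at this
    · refine hrK (hTK fun q hq => ?_)
      rw [← φ.map_add]
      rcases le_or_gt q 0 with hq0 | hq0
      · rw [φ.map_add]
        exact hstay r hr.1 (by linarith) q ⟨hq.1, hq0⟩
      rcases le_or_gt (q + r) s with hqs | hqs
      · exact hNK (hstay _ (by linarith [hr.1]) (by linarith))
      · have := interior_subset (hsU (q + r - s) ⟨by linarith, by linarith [hq.2]⟩)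
        rwa [← φ.map_add, sub_add_cancel] at this

lemma smul_orbitSegmentSet {G : Type*} [Group G] [MulAction G M]
    (hcomm : ∀ (g : G) (t : ℝ) (x : M), φ t (g • x) = g • φ t x) {a b : ℝ} {A : Set M} {g : G}
    (hA : g • A = A) : g • orbitSegmentSet φ a b A = orbitSegmentSet φ a b A := by
  ext x
  rw [mem_smul_set_iff_inv_smul_mem]
  refine forall₂_congr fun s _ => ?_
  rw [hcomm, ← mem_smul_set_iff_inv_smul_mem, hA]

end OrbitSegments

/-- (Floer; Pruszko: equivariant index pairs) Let `φ` be a flow on a locally compact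
metric space `M`, and let a compact topological group `G` act continuously on `M`,
commuting with the flow. If `S` is a `G`-invariant isolated invariant set admitting a
`G`-invariant isolating neighborhood, then `S` has an index pair `(N, L)` with both
`N` and `L` `G`-invariant. -/
theorem exists_equivariant_index_pair
    {M : Type*} [MetricSpace M] [LocallyCompactSpace M]
    (φ : Flow ℝ M)
    (G : Type*) [TopologicalSpace G] [Group G] [CompactSpace G]
    [MulAction G M] [ContinuousSMul G M]
    (hcomm : ∀ (g : G) (t : ℝ) (x : M), φ t (g • x) = g • φ t x)
    (S : Set M) (hS : IsIsolatedInvariantSet φ S)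
    (hSinv : ∀ g : G, g • S = S)
    (hGnbhd : ∃ N : Set M, IsIsolatingNbhd φ N ∧ S = maxInvariantSet φ N ∧
      ∀ g : G, g • N = N) :
    ∃ N L : Set M, IsIndexPair φ S N L ∧ (∀ g : G, g • N = N) ∧ (∀ g : G, g • L = L) := by
  obtain ⟨K, hK, rfl, hKinv⟩ := hGnbhd
  obtain ⟨T, hT, hTK⟩ := hK.exists_orbitSegmentSet_subset
  have hN (g : G) := smul_orbitSegmentSet hcomm (a := -T) (b := 0) (hKinv g)
  have hU (g : G) := smul_orbitSegmentSet hcomm (a := 0) (b := T) (A := interior K) (g := g)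
    (by rw [← interior_smul, hKinv])
  exact ⟨_, _, isIndexPair_orbitSegmentSet hK hT hTK, hN, fun g => by
    rw [smul_set_sdiff, hN, hU]⟩
end
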